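/- Let S be a nonempty compact right topological semigroup. If M is a nonempty closed subsemigroup of S that is minimal among nonempty closed subsemigroups of S (with respect to inclusion), then M is a singleton {e} for some idempotent e, i.e., e*e = e. -/

import Mathlib

/-- In a nonempty compact right topological semigroup, a nonempty closed subsemigroup `M`
that is minimal among nonempty closed subsemigroups is a singleton `{e}` with `e` an
idempotent. -/
theorem minimal_closed_subsemigroup_singleton_idempotent {S : Type*} [Semigroup S]
    [TopologicalSpace S] [CompactSpace S] [T2Space S] [Nonempty S]
    (hr : ∀ g : S, Continuous fun h : S => h * g)
    (M : Set S) (hMne : M.Nonempty) (hMcl : IsClosed M)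
    (hMmul : ∀ f ∈ M, ∀ g ∈ M, f * g ∈ M)
    (hmin : ∀ T : Set S, T.Nonempty → IsClosed T → (∀ f ∈ T, ∀ g ∈ T, f * g ∈ T) →
      T ⊆ M → T = M) :
    ∃ e : S, e * e = e ∧ M = {e} := by
  obtain ⟨e, he, hee⟩ := exists_idempotent_in_compact_subsemigroup hr M hMne hMcl.isCompact hMmul
  refine ⟨e, hee, (hmin {e} (Set.singleton_nonempty e) isClosed_singleton ?_
    (Set.singleton_subset_iff.mpr he)).symm⟩
  rintro _ rfl _ rfl
  exact hee
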